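/- arXiv:2212.00995 — 2 statements merged into one kernel-verified Lean document; each statement's English description precedes it below -/
import Mathlib

section
/- Let F be an algebraically closed field of characteristic zero and let P₁, P₂ be square matrices over F. Then the Kronecker sum Q = P₁ ⊗ I + I ⊗ P₂ is diagonalizable if and only if both P₁ and P₂ are diagonalizable. -/
open Matrix Kronecker

/-- `M` is diagonalizable over `F`: similar to a diagonal matrix. -/
def IsDiagonalizable {F : Type*} [Field F] {ι : Type*} [Fintype ι] [DecidableEq ι]
    (M : Matrix ι ι F) : Prop :=
  ∃ R D : Matrix ι ι F, IsUnit R.det ∧ D.IsDiag ∧ M = R⁻¹ * D * R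

lemma diag_of_span {F : Type*} [Field F] {ι : Type*} [Fintype ι] [DecidableEq ι]
    (M : Matrix ι ι F)
    (h : Submodule.span F {v : ι → F | ∃ c : F, M *ᵥ v = c • v} = ⊤) : IsDiagonalizable M := by
  let b := Module.Basis.ofSpan h.ge
  let b' : Module.Basis ι F (ι → F) := b.reindex (b.indexEquiv (Pi.basisFun F ι))
  have hb' : ∀ i, ∃ c : F, M *ᵥ (b' i) = c • b' i := by
    intro i
    have h1 : Set.range b ⊆ _ := Module.Basis.ofSpan_subset h.ge
    have h2 : b' i ∈ Set.range b := by
      simp [b']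
    exact h1 h2
  choose c hc using hb'
  let S : Matrix ι ι F := Matrix.of fun i j => b' j i
  have hS : IsUnit S := by
    rw [← Matrix.linearIndependent_cols_iff_isUnit]
    exact b'.linearIndependent
  have hSd : IsUnit S.det := (Matrix.isUnit_iff_isUnit_det S).mp hS
  refine ⟨S⁻¹, diagonal c, ?_, isDiag_diagonal c, ?_⟩
  · exact (Matrix.isUnit_nonsing_inv_det_iff).mpr hSd
  · have h3 : M * S = S * diagonal c := by
      ext i j
      have := congrFun (hc j) i
      rw [Matrix.mul_diagonal]
      simp only [Pi.smul_apply, smul_eq_mul] at this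
      rw [show S i j = b' j i from rfl, mul_comm, ← this]
      rfl
    rw [Matrix.nonsing_inv_nonsing_inv _ hSd, ← h3, Matrix.mul_nonsing_inv_cancel_right _ _ hSd]

lemma span_of_diag {F : Type*} [Field F] {ι : Type*} [Fintype ι] [DecidableEq ι]
    (M : Matrix ι ι F) (h : IsDiagonalizable M) :
    Submodule.span F {v : ι → F | ∃ c : F, M *ᵥ v = c • v} = ⊤ := by
  obtain ⟨R, D, hR, hD, rfl⟩ := h
  rw [eq_top_iff]
  intro v _
  have hv : v = ∑ i, (R *ᵥ v) i • (R⁻¹ *ᵥ Pi.single i 1) := by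
    have h1 : v = R⁻¹ *ᵥ (R *ᵥ v) := by
      rw [Matrix.mulVec_mulVec, Matrix.nonsing_inv_mul _ hR, Matrix.one_mulVec]
    have h2 : R *ᵥ v = ∑ i, (R *ᵥ v) i • (Pi.single i (1 : F) : ι → F) := by
      exact pi_eq_sum_univ' _
    conv_lhs => rw [h1, h2]
    rw [Matrix.mulVec_sum]
    simp only [Matrix.mulVec_smul]
  rw [hv]
  refine Submodule.sum_mem _ fun i _ => Submodule.smul_mem _ _ (Submodule.subset_span ⟨D i i, ?_⟩)
  rw [Matrix.mulVec_mulVec, Matrix.mul_nonsing_inv_cancel_right _ _ hR, ← Matrix.mulVec_mulVec,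
    ← Matrix.mulVec_smul]
  congr 1
  ext j
  by_cases hij : j = i
  · subst hij; simp
  · simp [hij, hD hij]

lemma diag_of_surj {F : Type*} [Field F] {ι κ : Type*} [Fintype ι] [DecidableEq ι]
    [Fintype κ] [DecidableEq κ] (M : Matrix ι ι F) (N : Matrix κ κ F)
    (f : (ι → F) →ₗ[F] (κ → F)) (hf : Function.Surjective f) (μ : F)
    (hc : ∀ x, f (M *ᵥ x) = N *ᵥ f x + μ • f x) (h : IsDiagonalizable M) :
    IsDiagonalizable N := by
  apply diag_of_span
  have h1 := span_of_diag M h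
  rw [eq_top_iff, ← LinearMap.range_eq_top.mpr hf, LinearMap.range_eq_map, ← h1,
    Submodule.map_span]
  apply Submodule.span_mono
  rintro _ ⟨v, ⟨c, hv⟩, rfl⟩
  refine ⟨c - μ, ?_⟩
  have := hc v
  rw [hv, map_smul] at this
  rw [sub_smul, this, add_sub_cancel_right]

lemma exists_left {F : Type*} [Field F] [IsAlgClosed F] {n : ℕ} (hn : 0 < n)
    (P : Matrix (Fin n) (Fin n) F) : ∃ (μ : F) (w : Fin n → F) (k : Fin n), w k ≠ 0 ∧
      ∀ j, ∑ i, w i * P i j = μ * w j := by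
  have : Nonempty (Fin n) := ⟨⟨0, hn⟩⟩
  obtain ⟨μ, hμ⟩ := Module.End.exists_eigenvalue (Matrix.toLin' Pᵀ)
  obtain ⟨w, hw⟩ := hμ.exists_hasEigenvector
  obtain ⟨k, hk⟩ := Function.ne_iff.mp hw.2
  refine ⟨μ, w, k, hk, fun j => ?_⟩
  have := congrFun hw.apply_eq_smul j
  simp only [Matrix.toLin'_apply, Matrix.mulVec, dotProduct, Matrix.transpose_apply,
    Pi.smul_apply, smul_eq_mul] at this
  rw [← this]
  exact Finset.sum_congr rfl fun i _ => mul_comm _ _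

/-- Entries of the Kronecker sum applied to a vector. -/
theorem kron_mulVec {F : Type*} [Field F] {m n : ℕ}
    (P₁ : Matrix (Fin m) (Fin m) F) (P₂ : Matrix (Fin n) (Fin n) F) (x : Fin m × Fin n → F)
    (a : Fin m) (b : Fin n) :
    ((P₁ ⊗ₖ (1 : Matrix (Fin n) (Fin n) F) + (1 : Matrix (Fin m) (Fin m) F) ⊗ₖ P₂) *ᵥ x) (a, b)
      = ∑ c, P₁ a c * x (c, b) + ∑ d, P₂ b d * x (a, d) := by
  simp [add_mul, Finset.sum_add_distrib, Matrix.mulVec, dotProduct, Fintype.sum_prod_type, Matrix.one_apply,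
    kroneckerMap_apply]

/-- Over an algebraically closed field of characteristic zero, the Kronecker sum
`Q = P₁ ⊗ I + I ⊗ P₂` is diagonalizable iff both `P₁` and `P₂` are diagonalizable. -/
theorem stmt6 {F : Type*} [Field F] [IsAlgClosed F] [CharZero F]
    {m n : ℕ} (hm : 0 < m) (hn : 0 < n)
    (P₁ : Matrix (Fin m) (Fin m) F) (P₂ : Matrix (Fin n) (Fin n) F) :
    IsDiagonalizable
        (P₁ ⊗ₖ (1 : Matrix (Fin n) (Fin n) F) + (1 : Matrix (Fin m) (Fin m) F) ⊗ₖ P₂) ↔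
      (IsDiagonalizable P₁ ∧ IsDiagonalizable P₂) := by
  constructor
  · intro h
    constructor
    · obtain ⟨μ, w, k, hk, hw⟩ := exists_left hn P₂
      let f : (Fin m × Fin n → F) →ₗ[F] (Fin m → F) :=
        { toFun := fun x a => ∑ b, w b * x (a, b)
          map_add' := by intro x y; ext a; simp [mul_add, Finset.sum_add_distrib]
          map_smul' := by intro c x; ext a; simp [Finset.mul_sum, mul_left_comm] }
      have hf : ∀ x a, f x a = ∑ b, w b * x (a, b) := fun _ _ => rfl
      refine diag_of_surj _ P₁ f ?_ μ ?_ h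
      · intro y
        refine ⟨fun p => if p.2 = k then (w k)⁻¹ * y p.1 else 0, ?_⟩
        ext a
        simp [hf, hk]
      · intro x
        ext a
        simp only [hf, kron_mulVec, Pi.add_apply]
        simp only [hf, Pi.add_apply, Pi.smul_apply, smul_eq_mul, Matrix.mulVec,
          dotProduct, mul_add, Finset.sum_add_distrib, Finset.mul_sum]
        congr 1
        · rw [Finset.sum_comm]
          simp only [mul_left_comm]
        · rw [Finset.sum_comm]
          refine Finset.sum_congr rfl fun j _ => ?_
          rw [← mul_assoc, ← hw j, Finset.sum_mul]
          simp only [mul_assoc]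
    · obtain ⟨μ, w, k, hk, hw⟩ := exists_left hm P₁
      let f : (Fin m × Fin n → F) →ₗ[F] (Fin n → F) :=
        { toFun := fun x b => ∑ a, w a * x (a, b)
          map_add' := by intro x y; ext a; simp [mul_add, Finset.sum_add_distrib]
          map_smul' := by intro c x; ext a; simp [Finset.mul_sum, mul_left_comm] }
      have hf : ∀ x b, f x b = ∑ a, w a * x (a, b) := fun _ _ => rfl
      refine diag_of_surj _ P₂ f ?_ μ ?_ h
      · intro y
        refine ⟨fun p => if p.1 = k then (w k)⁻¹ * y p.2 else 0, ?_⟩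
        ext a
        simp [hf, hk]
      · intro x
        ext a
        simp only [hf, kron_mulVec, Pi.add_apply]
        simp only [hf, Pi.add_apply, Pi.smul_apply, smul_eq_mul, Matrix.mulVec,
          dotProduct, mul_add, Finset.sum_add_distrib, Finset.mul_sum]
        rw [add_comm]
        congr 1
        · rw [Finset.sum_comm]
          simp only [mul_left_comm]
        · rw [Finset.sum_comm]
          refine Finset.sum_congr rfl fun j _ => ?_
          rw [← mul_assoc, ← hw j, Finset.sum_mul]
          simp only [mul_assoc]
  · rintro ⟨⟨R₁, D₁, hR₁, hD₁, rfl⟩, ⟨R₂, D₂, hR₂, hD₂, rfl⟩⟩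
    refine ⟨R₁ ⊗ₖ R₂, D₁ ⊗ₖ 1 + 1 ⊗ₖ D₂, ?_, ?_, ?_⟩
    · rw [Matrix.det_kronecker]
      exact (hR₁.pow _).mul (hR₂.pow _)
    · exact (hD₁.kronecker isDiag_one).add (isDiag_one.kronecker hD₂)
    · rw [Matrix.inv_kronecker, Matrix.mul_add, Matrix.add_mul]
      simp only [← Matrix.mul_kronecker_mul, Matrix.mul_one, Matrix.nonsing_inv_mul _ hR₁,
        Matrix.nonsing_inv_mul _ hR₂]
end

section
/- Let F be a field of characteristic zero, K = F(t), δ the derivation with δ|_F = 0 and δ(t) = t, and P ∈ Mₙ(F) a traceless matrix. Then the differential matrix algebra (Mₙ(K), D_P), with D_P(X) = δ^c(X) + PX − XP, admits a finite splitting field over (K, δ) if and only if P is diagonalizable over the algebraic closure of F and every eigenvalue of P is rational. -/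
set_option synthInstance.maxHeartbeats 1000000
set_option maxHeartbeats 2000000
open Matrix
open scoped Differential
section
open Polynomial
lemma aux1 {Λ E : Type*} [Field Λ] [Field E] [CharZero Λ] [Algebra Λ E] [Differential Λ]
   [Differential E] [DifferentialAlgebra Λ E] [FiniteDimensional Λ E] (y : E) (hy : y ≠ 0) (c : Λ)
   (h : y′ = algebraMap Λ E c * y) : ∃ (m : ℕ) (a : Λ), 0 < m ∧ a ≠ 0 ∧ a′ = m * c * a := by
  have hi : IsIntegral Λ y := IsIntegral.of_finite Λ y
  set p := minpoly Λ y with hp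
  have hm : p.Monic := minpoly.monic hi
  refine ⟨p.natDegree, p.coeff 0, minpoly.natDegree_pos hi, minpoly.coeff_zero_ne_zero hi hy, ?_⟩
  set q := Differential.mapCoeffs p + C c * (X * derivative p) - C (p.natDegree * c) * p with hq
  have hq0 : aeval y q = 0 := by
    have := Differential.deriv_aeval_eq y p
    rw [hp, minpoly.aeval, ← hp] at this
    simp only [map_zero] at this
    simp only [hq, map_add, map_sub, map_mul, aeval_C, aeval_X]
    rw [hp, minpoly.aeval, ← hp, mul_zero, sub_zero]
    rw [this, h]; ring
  have hcoef : ∀ i, q.coeff i = (p.coeff i)′ + c * (i * p.coeff i) - p.natDegree * c * p.coeff i := by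
    intro i
    rw [hq, coeff_sub, coeff_add, Differential.coeff_mapCoeffs, coeff_C_mul, coeff_C_mul]
    rcases i with _ | i
    · simp
    · rw [coeff_X_mul, coeff_derivative]; push_cast; ring
  have hz : q = 0 := by
    by_contra hne
    have h1 := minpoly.min Λ y hm
    have h2 := minpoly.degree_le_of_ne_zero Λ y hne hq0
    rw [← hp] at h2
    have h3 : q.degree < p.degree := by
      rw [degree_eq_natDegree hm.ne_zero, degree_lt_iff_coeff_zero]
      intro i hi
      rw [hcoef]
      rcases hi.eq_or_lt with rfl | hi
      · rw [hm.coeff_natDegree]; simp; ring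
      · rw [coeff_eq_zero_of_natDegree_lt hi]; simp
    exact absurd h2 (not_le.mpr h3)
  have := hcoef 0
  rw [hz] at this
  simp at this
  linear_combination -this

lemma aux2 {Λ E : Type*} [Field Λ] [Field E] [CharZero Λ] [Algebra Λ E] [Differential Λ]
   [Differential E] [DifferentialAlgebra Λ E] [FiniteDimensional Λ E] (y : E)
   (h : y′ = 1) : ∃ (a : Λ), a′ = 1 := by
  have hi : IsIntegral Λ y := IsIntegral.of_finite Λ y
  set p := minpoly Λ y with hp
  have hm : p.Monic := minpoly.monic hi
  have hpos : 0 < p.natDegree := minpoly.natDegree_pos hi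
  set q := Differential.mapCoeffs p + derivative p with hq
  have hq0 : aeval y q = 0 := by
    have := Differential.deriv_aeval_eq y p
    rw [hp, minpoly.aeval, ← hp] at this
    simp only [map_zero] at this
    simp only [hq, map_add]
    rw [this, h]; ring
  have hcoef : ∀ i, q.coeff i = (p.coeff i)′ + p.coeff (i+1) * (i + 1) := by
    intro i
    rw [hq, coeff_add, Differential.coeff_mapCoeffs, coeff_derivative]
  have hz : q = 0 := by
    by_contra hne
    have h2 := minpoly.degree_le_of_ne_zero Λ y hne hq0
    rw [← hp] at h2
    have h3 : q.degree < p.degree := by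
      rw [degree_eq_natDegree hm.ne_zero, degree_lt_iff_coeff_zero]
      intro i hi
      rw [hcoef, coeff_eq_zero_of_natDegree_lt (n := i + 1) (by omega)]
      rcases hi.eq_or_lt with rfl | hi
      · rw [hm.coeff_natDegree]; simp
      · rw [coeff_eq_zero_of_natDegree_lt hi]; simp
    exact absurd h2 (not_le.mpr h3)
  obtain ⟨m, hm'⟩ : ∃ m, p.natDegree = m + 1 := ⟨p.natDegree - 1, by omega⟩
  have := hcoef m
  rw [hz, ← hm', hm.coeff_natDegree] at this
  simp at this
  have hm0 : ((m : Λ) + 1) ≠ 0 := by exact_mod_cast Nat.succ_ne_zero m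
  refine ⟨-p.coeff m / ((m + 1 : ℕ) : Λ), ?_⟩
  rw [Derivation.leibniz_div_const _ _ _ (by simp), map_neg]
  push_cast
  rw [smul_eq_mul, inv_mul_eq_div, div_eq_iff hm0]
  linear_combination this

end

/-- Euler operator. -/
noncomputable def eulerFun {C : Type*} [Field C] (f : LaurentSeries C) : LaurentSeries C :=
  ⟨fun n => (n : C) * f.coeff n, f.isPWO_support.mono (fun n hn => by
    simp only [Function.mem_support] at hn
    exact right_ne_zero_of_mul hn)⟩

lemma eulerFun_coeff {C : Type*} [Field C] (f : LaurentSeries C) (n : ℤ) :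
   (eulerFun f).coeff n = n * f.coeff n := rfl

lemma eulerFun_supp {C : Type*} [Field C] (f : LaurentSeries C) : (eulerFun f).support ⊆ f.support := by
  intro n hn
  exact right_ne_zero_of_mul hn

lemma eulerFun_mul {C : Type*} [Field C] (f g : LaurentSeries C) :
    eulerFun (f * g) = f * eulerFun g + g * eulerFun f := by
  rw [mul_comm g]
  ext n
  rw [HahnSeries.coeff_add, eulerFun_coeff, HahnSeries.coeff_mul,
    HahnSeries.coeff_mul_left' f.isPWO_support (eulerFun_supp f),
    HahnSeries.coeff_mul_right' g.isPWO_support (eulerFun_supp g), ← Finset.sum_add_distrib,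
    Finset.mul_sum]
  refine Finset.sum_congr rfl fun ij hij => ?_
  rw [eulerFun_coeff, eulerFun_coeff]
  have : ij.1 + ij.2 = n := by simpa using (Finset.mem_antidiagonal.mp hij).2.2
  rw [← this]; push_cast; ring

/-- Build a differential structure from a raw function. -/
@[reducible]
noncomputable def mkDiff {R : Type*} [CommRing R] (f : R → R)
    (hadd : ∀ x y, f (x + y) = f x + f y) (hmul : ∀ x y, f (x * y) = f x * y + x * f y) :
    Differential R where
  deriv := Derivation.mk' (AddMonoidHom.toIntLinearMap (AddMonoidHom.mk' f hadd))
    (fun a b => by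
      simp only [AddMonoidHom.coe_toIntLinearMap, AddMonoidHom.mk'_apply, smul_eq_mul]
      rw [hmul]; ring)

lemma mkDiff_deriv {R : Type*} [CommRing R] (f : R → R)
    (hadd : ∀ x y, f (x + y) = f x + f y) (hmul : ∀ x y, f (x * y) = f x * y + x * f y) (x : R) :
    (mkDiff f hadd hmul).deriv x = f x := rfl

lemma eulerFun_add {C : Type*} [Field C] (f g : LaurentSeries C) :
    eulerFun (f + g) = eulerFun f + eulerFun g := by
  ext; simp [eulerFun_coeff, mul_add]

@[reducible]
noncomputable def eulerDiff (C : Type*) [Field C] : Differential (LaurentSeries C) :=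
  mkDiff eulerFun eulerFun_add
    (fun x y => by rw [eulerFun_mul]; ring)


noncomputable def polyToLaurent (F : Type*) [Field F] :
    Polynomial F →+* LaurentSeries (AlgebraicClosure F) :=
  (algebraMap (Polynomial (AlgebraicClosure F)) (LaurentSeries (AlgebraicClosure F))).comp
    (Polynomial.mapRingHom (algebraMap F (AlgebraicClosure F)))

lemma polyToLaurent_inj (F : Type*) [Field F] : Function.Injective (polyToLaurent F) :=
  (FaithfulSMul.algebraMap_injective _ _).comp
    (Polynomial.map_injective _ (algebraMap F (AlgebraicClosure F)).injective)

lemma polyToLaurent_C (F : Type*) [Field F] (a : F) :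
    polyToLaurent F (Polynomial.C a) = HahnSeries.C (algebraMap F (AlgebraicClosure F) a) := by
  simp [polyToLaurent]

lemma polyToLaurent_X (F : Type*) [Field F] :
    polyToLaurent F Polynomial.X = HahnSeries.single 1 1 := by
  simp [polyToLaurent]

@[reducible]
noncomputable def ratToLaurent (F : Type*) [Field F] :
    RatFunc F →+* LaurentSeries (AlgebraicClosure F) :=
  IsFractionRing.lift (polyToLaurent_inj F)

lemma ratToLaurent_alg (F : Type*) [Field F] (p : Polynomial F) :
    ratToLaurent F (algebraMap _ _ p) = polyToLaurent F p :=
  IsFractionRing.lift_algebraMap _ _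

lemma eulerFun_C {C : Type*} [Field C] (a : C) : eulerFun (HahnSeries.C a) = 0 := by
  ext n
  rw [eulerFun_coeff, HahnSeries.C_apply, HahnSeries.coeff_single]
  split_ifs with h <;> simp [h]

lemma eulerFun_X {C : Type*} [Field C] :
    eulerFun (HahnSeries.single 1 1 : LaurentSeries C) = HahnSeries.single 1 1 := by
  ext n
  rw [eulerFun_coeff, HahnSeries.coeff_single]
  split_ifs with h <;> simp [h]

lemma ratToLaurent_deriv {F : Type*} [Field F] (δ : RatFunc F → RatFunc F)
    (hadd : ∀ x y : RatFunc F, δ (x + y) = δ x + δ y)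
    (hmul : ∀ x y : RatFunc F, δ (x * y) = δ x * y + x * δ y)
    (hF : ∀ a : F, δ (algebraMap F (RatFunc F) a) = 0)
    (ht : δ RatFunc.X = RatFunc.X) (x : RatFunc F) :
    eulerFun (ratToLaurent F x) = ratToLaurent F (δ x) := by
  have hX : ratToLaurent F RatFunc.X = HahnSeries.single 1 1 := by
    rw [← RatFunc.algebraMap_X, ratToLaurent_alg, polyToLaurent_X]
  have key : ∀ p : Polynomial F, eulerFun (ratToLaurent F (algebraMap _ _ p)) =
      ratToLaurent F (δ (algebraMap _ _ p)) := by
    intro p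
    induction p using Polynomial.induction_on with
    | C a =>
      rw [RatFunc.algebraMap_C, ← RatFunc.algebraMap_eq_C, hF, map_zero, RatFunc.algebraMap_eq_C,
        ← RatFunc.algebraMap_C, ratToLaurent_alg, polyToLaurent_C, eulerFun_C]
    | add p q hp hq => rw [map_add, hadd, map_add, map_add, eulerFun_add, hp, hq]
    | monomial n a ih =>
      rw [pow_succ, ← mul_assoc]
      generalize Polynomial.C a * Polynomial.X ^ n = r at ih ⊢
      rw [map_mul, hmul, map_mul, eulerFun_mul, ih, RatFunc.algebraMap_X,
        ht, map_add, map_mul, map_mul, hX, eulerFun_X]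
      ring
  obtain ⟨p, q, hq, rfl⟩ := IsFractionRing.div_surjective (A := Polynomial F) x
  have hq0 : algebraMap (Polynomial F) (RatFunc F) q ≠ 0 := by
    simpa using nonZeroDivisors.ne_zero hq
  set a := algebraMap (Polynomial F) (RatFunc F) p
  set b := algebraMap (Polynomial F) (RatFunc F) q
  have h1 : a / b * b = a := div_mul_cancel₀ _ hq0
  have h2 := key p
  change eulerFun (ratToLaurent F a) = ratToLaurent F (δ a) at h2
  rw [← h1, hmul, map_mul, eulerFun_mul, key q, map_add, map_mul, map_mul] at h2
  have h3 : ratToLaurent F b ≠ 0 := by simpa using hq0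
  apply mul_right_cancel₀ h3
  linear_combination h2

lemma exists_compositum {K E Λ : Type*} [Field K] [Field E] [Field Λ] [CharZero K] [CharZero Λ]
    [Algebra K E]
    [Algebra K Λ] [Differential K] [Differential E] [Differential Λ] [DifferentialAlgebra K E]
    [DifferentialAlgebra K Λ] [FiniteDimensional K E] :
    ∃ (E' : IntermediateField Λ (AlgebraicClosure Λ)) (_dE : Differential E')
      (f : E →+* E'), FiniteDimensional Λ E' ∧ DifferentialAlgebra Λ E' ∧ (∀ x, f (x′) = (f x)′) ∧
      ∀ x, f (algebraMap K E x) = algebraMap Λ E' (algebraMap K Λ x) := by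
  let g : E →ₐ[K] AlgebraicClosure Λ := IsAlgClosed.lift
  let b := Module.finBasis K E
  let E' := IntermediateField.adjoin Λ (Set.range (fun i => g (b i)))
  have hfin : FiniteDimensional Λ E' := by
    apply IntermediateField.finiteDimensional_adjoin
    intro x _
    exact Algebra.IsIntegral.isIntegral x
  have hmem : ∀ x, g x ∈ E' := by
    intro x
    rw [← b.sum_repr x, map_sum]
    refine sum_mem fun i _ => ?_
    rw [map_smul, Algebra.smul_def, IsScalarTower.algebraMap_apply K Λ]
    exact mul_mem (E'.algebraMap_mem _) (IntermediateField.subset_adjoin _ _ ⟨i, rfl⟩)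
  let dE : Differential E' := Differential.differentialFiniteDimensional Λ E'
  have hd : DifferentialAlgebra Λ E' := Differential.differentialAlgebraFiniteDimensional
  let f : E →+* E' := g.toRingHom.codRestrict E'.toSubfield.toSubring.toSubsemiring hmem
  have hf : ∀ x, f (algebraMap K E x) = algebraMap Λ E' (algebraMap K Λ x) := by
    intro x
    apply Subtype.ext
    change g (algebraMap K E x) = algebraMap Λ (AlgebraicClosure Λ) (algebraMap K Λ x)
    rw [AlgHom.commutes, ← IsScalarTower.algebraMap_apply]
  refine ⟨E', dE, f, hfin, hd, ?_, hf⟩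
  let : Algebra K E' := ((algebraMap Λ E').comp (algebraMap K Λ)).toAlgebra
  have : DifferentialAlgebra K E' := ⟨fun a => by
    change (algebraMap Λ E' (algebraMap K Λ a))′ = algebraMap Λ E' (algebraMap K Λ a′)
    rw [deriv_algebraMap, deriv_algebraMap]⟩
  let f' : E →ₐ[K] E' := { f with commutes' := hf }
  intro x
  exact Differential.algHom_deriv' f' f'.toRingHom.injective x

lemma diag_of_semisimple {C : Type*} [Field C] [IsAlgClosed C] {n : ℕ}
    (P : Matrix (Fin n) (Fin n) C)
    (h : ∀ (μ : C) (v : Fin n → C), 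
      P *ᵥ (P *ᵥ v - μ • v) - μ • (P *ᵥ v - μ • v) = 0 → P *ᵥ v - μ • v = 0) :
    ∃ R D : Matrix (Fin n) (Fin n) C, IsUnit R.det ∧ D.IsDiag ∧ P = R⁻¹ * D * R := by
  classical
  set f : Module.End C (Fin n → C) := toLin' P with hf
  have hE : ∀ μ, f.maxGenEigenspace μ = f.eigenspace μ := by
    intro μ
    apply le_antisymm
    · intro x hx
      rw [Module.End.mem_maxGenEigenspace] at hx
      obtain ⟨k, hk⟩ := hx
      rw [Module.End.mem_eigenspace_iff, ← sub_eq_zero]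
      have : ∀ k : ℕ, ∀ x, ((f - μ • (1 : Module.End C (Fin n → C))) ^ k) x = 0 → f x - μ • x = 0 := by
        intro k
        induction k with
        | zero => intro x hx; simp at hx; simp [hx]
        | succ k ih =>
          intro x hx
          rw [pow_succ] at hx
          have := ih _ hx
          exact h μ x this
      exact this k x hk
    · intro x hx
      rw [Module.End.mem_maxGenEigenspace]
      rw [Module.End.mem_eigenspace_iff] at hx
      exact ⟨1, by simp [hx]⟩
  have htop : ⨆ μ, f.eigenspace μ = ⊤ := by
    rw [← Module.End.iSup_maxGenEigenspace_eq_top f]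
    simp_rw [hE]
  have hint := DirectSum.isInternal_submodule_of_iSupIndep_of_iSup_eq_top
    f.eigenspaces_iSupIndep htop
  let b0 := hint.collectedBasis (fun μ => Module.Free.chooseBasis C (f.eigenspace μ))
  have := Module.Finite.finite_basis b0
  let := Fintype.ofFinite (Σ μ, Module.Free.ChooseBasisIndex C (f.eigenspace μ))
  have hcard : Fintype.card (Σ μ, Module.Free.ChooseBasisIndex C (f.eigenspace μ)) = n := by
    rw [← Module.finrank_eq_card_basis b0]; simp
  let e := Fintype.equivFinOfCardEq hcard
  let b := b0.reindex e
  have hb : ∀ i, P *ᵥ (b i) = (e.symm i).1 • b i := by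
    intro i
    have : b i ∈ f.eigenspace (e.symm i).1 := by
      simp only [b, Module.Basis.reindex_apply]
      exact hint.collectedBasis_mem _ _
    rw [Module.End.mem_eigenspace_iff] at this
    simpa [hf] using this
  let S : Matrix (Fin n) (Fin n) C := (Pi.basisFun C (Fin n)).toMatrix b
  have hS : ∀ i j, S i j = b j i := by intro i j; simp [S, Module.Basis.toMatrix_apply]
  have hSu : IsUnit S.det := by
    have := (Pi.basisFun C (Fin n)).isUnit_det b
    rwa [Module.Basis.det_apply] at this
  refine ⟨S⁻¹, diagonal (fun i => (e.symm i).1), ?_, isDiag_diagonal _, ?_⟩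
  · rw [Matrix.det_nonsing_inv]; simpa using hSu
  · have : P * S = S * diagonal (fun i => (e.symm i).1) := by
      ext i j
      rw [mul_diagonal, hS]
      have := congrFun (hb j) i
      simp only [Pi.smul_apply, smul_eq_mul] at this
      rw [mul_comm, ← this]
      simp [mul_apply, mulVec, dotProduct, hS]
    rw [nonsing_inv_nonsing_inv _ hSu, ← this, Matrix.mul_assoc, mul_nonsing_inv _ hSu, mul_one]

lemma forward_core {C Λ E : Type*} [Field C] [IsAlgClosed C] [CharZero C] [Field Λ] [CharZero Λ]
    [Field E] [Algebra Λ E]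
    [Differential Λ] [Differential E] [DifferentialAlgebra Λ E] [FiniteDimensional Λ E]
    (ι : C →+* Λ) (hι : ∀ c, (ι c)′ = 0)
    (H1 : ∀ (a : Λ) (c : C), a ≠ 0 → a′ = ι c * a → ∃ k : ℤ, c = k)
    (H2 : ∀ a : Λ, a′ ≠ 1) {n : ℕ} (P : Matrix (Fin n) (Fin n) C)
    (Y : Matrix (Fin n) (Fin n) E) (hY : IsUnit Y.det)
    (hP : ∀ i j, (Y i j)′ = ∑ k, algebraMap Λ E (ι (P k i)) * Y k j) :
    (∃ R D : Matrix (Fin n) (Fin n) C, IsUnit R.det ∧ D.IsDiag ∧ P = R⁻¹ * D * R) ∧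
      ∀ μ ∈ spectrum C P, ∃ q : ℚ, μ = (q : C) := by
  let κ : C →+* E := (algebraMap Λ E).comp ι
  have hκ : ∀ c, (κ c)′ = 0 := fun c => by
    change (algebraMap Λ E (ι c))′ = 0
    rw [deriv_algebraMap, hι, map_zero]
  let φ : (Fin n → C) → (Fin n → E) := fun v => (fun i => κ (v i)) ᵥ* Y
  have hφ0 : ∀ v, φ v = 0 → v = 0 := by
    intro v hv
    have : (fun i => κ (v i)) = 0 := by
      by_contra hne
      exact hY.ne_zero (Matrix.exists_vecMul_eq_zero_iff.mp ⟨_, hne, hv⟩)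
    ext i
    have := congrFun this i
    simpa using this
  have hφs : ∀ v w i, φ (v + w) i = φ v i + φ w i := by
    intro v w i
    simp [φ, vecMul, dotProduct, add_mul, Finset.sum_add_distrib]
  have hφm : ∀ (c : C) v i, φ (c • v) i = κ c * φ v i := by
    intro c v i
    simp [φ, vecMul, dotProduct, Finset.mul_sum, mul_assoc]
  have hφd : ∀ v i, (φ v i)′ = φ (P *ᵥ v) i := by
    intro v j
    simp only [φ, vecMul, dotProduct, map_sum, Derivation.leibniz, hκ, mul_zero, add_zero,
      smul_eq_mul, hP, mulVec, map_mul, Finset.mul_sum, Finset.sum_mul]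
    rw [Finset.sum_comm]
    refine Finset.sum_congr rfl fun k _ => Finset.sum_congr rfl fun i _ => ?_
    simp only [κ, RingHom.comp_apply]
    ring
  have hex : ∀ v, v ≠ 0 → ∃ i, φ v i ≠ 0 := by
    intro v hv
    by_contra hne
    push Not at hne
    exact hv (hφ0 v (funext hne))
  constructor
  · apply diag_of_semisimple
    intro μ v hv
    by_contra hu
    set u := P *ᵥ v - μ • v with hu'
    obtain ⟨i, hi⟩ := hex u hu
    have e1 : (φ u i)′ = κ μ * φ u i := by
      rw [hφd, sub_eq_zero.mp hv, hφm]
    have e2 : (φ v i)′ = κ μ * φ v i + φ u i := by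
      rw [hφd, ← hφm, ← hφs]; congr 1; rw [hu']; abel_nf
    have e3 : (φ v i / φ u i)′ = 1 := by
      rw [Derivation.leibniz_div, e1, e2]
      simp only [smul_eq_mul]
      field_simp
      ring
    obtain ⟨a, ha⟩ := aux2 (Λ := Λ) _ e3
    exact H2 a ha
  · intro μ hμ
    rw [← spectrum_toLin', ← Module.End.hasEigenvalue_iff_mem_spectrum] at hμ
    obtain ⟨u, hu⟩ := hμ.exists_hasEigenvector
    obtain ⟨i, hi⟩ := hex u hu.2
    have hPu : P *ᵥ u = μ • u := by simpa using hu.apply_eq_smul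
    have e1 : (φ u i)′ = algebraMap Λ E (ι μ) * φ u i := by
      rw [hφd, hPu, hφm]; rfl
    obtain ⟨m, a, hm, ha, hd⟩ := aux1 _ hi _ e1
    obtain ⟨k, hk⟩ := H1 a (m * μ) ha (by rw [hd]; simp)
    refine ⟨(k : ℚ) / m, ?_⟩
    have : (m : C) ≠ 0 := by exact_mod_cast hm.ne'
    push_cast
    rw [eq_div_iff this, ← hk, mul_comm]

lemma laurent_H1 {C : Type*} [Field C] (a : LaurentSeries C) (c : C) (ha : a ≠ 0)
    (h : eulerFun a = HahnSeries.C c * a) : ∃ k : ℤ, c = k := by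
  obtain ⟨k, hk⟩ : ∃ k, a.coeff k ≠ 0 := by
    by_contra hne
    push Not at hne
    exact ha (HahnSeries.ext (funext hne))
  refine ⟨k, ?_⟩
  have := congrArg (fun f => HahnSeries.coeff f k) h
  simp only [eulerFun_coeff, HahnSeries.C_mul_eq_smul, HahnSeries.coeff_smul, smul_eq_mul] at this
  exact (mul_right_cancel₀ hk this).symm

lemma laurent_H2 {C : Type*} [Field C] (a : LaurentSeries C) : eulerFun a ≠ 1 := by
  intro h
  have := congrArg (fun f => HahnSeries.coeff f 0) h
  simp [eulerFun_coeff] at this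

lemma forward {F : Type*} [Field F] [CharZero F] {n : ℕ}
    (δ : RatFunc F → RatFunc F)
    (hadd : ∀ x y : RatFunc F, δ (x + y) = δ x + δ y)
    (hmul : ∀ x y : RatFunc F, δ (x * y) = δ x * y + x * δ y)
    (hF : ∀ a : F, δ (algebraMap F (RatFunc F) a) = 0)
    (ht : δ RatFunc.X = RatFunc.X)
    (P : Matrix (Fin n) (Fin n) F) {E : Type*} [Field E] [Algebra (RatFunc F) E]
    [FiniteDimensional (RatFunc F) E] (δE : E → E)
    (eadd : ∀ x y : E, δE (x + y) = δE x + δE y)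
    (emul : ∀ x y : E, δE (x * y) = δE x * y + x * δE y)
    (ealg : ∀ a : RatFunc F,
          δE (algebraMap (RatFunc F) E a) = algebraMap (RatFunc F) E (δ a))
    (Y : Matrix (Fin n) (Fin n) E) (hY : IsUnit Y.det)
    (hYP : Y.map δE
            = (P.map fun x =>
                algebraMap (RatFunc F) E (algebraMap F (RatFunc F) x))ᵀ * Y) :
      ((∃ R D : Matrix (Fin n) (Fin n) (AlgebraicClosure F),
          IsUnit R.det ∧ D.IsDiag ∧
            P.map (algebraMap F (AlgebraicClosure F)) = R⁻¹ * D * R) ∧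
        ∀ μ ∈ spectrum (AlgebraicClosure F) (P.map (algebraMap F (AlgebraicClosure F))),
          ∃ q : ℚ, μ = (q : AlgebraicClosure F)) := by
  let dK : Differential (RatFunc F) := mkDiff δ hadd hmul
  let dE : Differential E := mkDiff δE eadd emul
  let dL : Differential (LaurentSeries (AlgebraicClosure F)) := eulerDiff _
  have hKE : DifferentialAlgebra (RatFunc F) E := ⟨ealg⟩
  let aL : Algebra (RatFunc F) (LaurentSeries (AlgebraicClosure F)) := (ratToLaurent F).toAlgebra
  have hKL : DifferentialAlgebra (RatFunc F) (LaurentSeries (AlgebraicClosure F)) :=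
    ⟨ratToLaurent_deriv δ hadd hmul hF ht⟩
  have : CharZero (LaurentSeries (AlgebraicClosure F)) :=
    charZero_of_injective_ringHom (HahnSeries.C (Γ := ℤ) (R := AlgebraicClosure F)).injective
  have : CharZero (RatFunc F) :=
    charZero_of_injective_ringHom (algebraMap F (RatFunc F)).injective
  obtain ⟨E', dE', f, hfin, hdiff, hfd, hfa⟩ := exists_compositum (K := RatFunc F) (E := E)
    (Λ := LaurentSeries (AlgebraicClosure F))
  refine forward_core (Λ := LaurentSeries (AlgebraicClosure F)) (E := E') HahnSeries.C eulerFun_C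
    laurent_H1 laurent_H2 _ (Y.map f) ?_ ?_
  · have := hY.map f
    rwa [RingHom.map_det] at this
  · intro i j
    rw [map_apply, ← hfd]
    have := congrFun (congrFun hYP i) j
    change δE (Y i j) = _ at this
    change f (δE (Y i j)) = _
    rw [this, mul_apply, map_sum]
    refine Finset.sum_congr rfl fun k _ => ?_
    simp only [transpose_apply, map_apply, map_mul, hfa]
    congr 2
    change ratToLaurent F _ = _
    rw [RatFunc.algebraMap_eq_C, ← RatFunc.algebraMap_C, ratToLaurent_alg, polyToLaurent_C]

lemma const_of_alg {F E : Type*} [Field F] [CharZero F] [Field E] [Algebra F E] [Differential E]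
    (h : ∀ a : F, (algebraMap F E a)′ = 0) (x : E) (hx : IsIntegral F x) : x′ = 0 := by
  let dF : Differential F := ⟨0⟩
  have : DifferentialAlgebra F E := ⟨fun a => by rw [h]; exact (map_zero _).symm⟩
  have h1 := Differential.deriv_aeval_eq x (minpoly F x)
  have h2 : Differential.mapCoeffs (minpoly F x) = 0 := by
    ext i; rw [Differential.coeff_mapCoeffs]; rfl
  rw [h2, minpoly.aeval, map_zero, map_zero, zero_add] at h1
  have h3 := (minpoly.irreducible hx).separable.aeval_derivative_ne_zero (minpoly.aeval F x)
  exact (mul_eq_zero.mp h1.symm).resolve_left h3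

lemma root_deriv {E : Type*} [Field E] [CharZero E] [Differential E] (t u : E) (ht0 : t ≠ 0)
    (ht : t′ = t) (q : ℚ) (hu : u ^ q.den = t ^ q.num) : u′ = (q : E) * u := by
  have hd : (q.den : E) ≠ 0 := by exact_mod_cast q.den_nz
  have hu0 : u ≠ 0 := by
    rintro rfl
    rw [zero_pow q.den_nz] at hu
    exact zpow_ne_zero _ ht0 hu.symm
  have h1 := congrArg (fun x => (Differential.deriv x : E)) hu
  simp only [Derivation.leibniz_zpow, Derivation.leibniz_pow, ht, smul_eq_mul, nsmul_eq_mul,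
    zsmul_eq_mul] at h1
  have h2 : t ^ (q.num - 1) * t = t ^ q.num := by
    rw [zpow_sub_one₀ ht0, inv_mul_cancel_right₀ ht0]
  rw [h2, ← hu] at h1
  have h3 : u ^ q.den = u ^ (q.den - 1) * u := by
    rw [← pow_succ, Nat.sub_add_cancel q.pos]
  rw [h3] at h1
  have h4 : u ^ (q.den - 1) ≠ 0 := pow_ne_zero _ hu0
  have h5 : (q.den : E) * u′ = q.num * u := by
    apply mul_left_cancel₀ h4
    linear_combination h1
  rw [Rat.cast_def, div_mul_eq_mul_div, eq_div_iff hd, ← h5, mul_comm]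

lemma backward {F : Type*} [Field F] [CharZero F] {n : ℕ}
    (δ : RatFunc F → RatFunc F)
    (hadd : ∀ x y : RatFunc F, δ (x + y) = δ x + δ y)
    (hmul : ∀ x y : RatFunc F, δ (x * y) = δ x * y + x * δ y)
    (hF : ∀ a : F, δ (algebraMap F (RatFunc F) a) = 0)
    (ht : δ RatFunc.X = RatFunc.X)
    (P : Matrix (Fin n) (Fin n) F)
    (R D : Matrix (Fin n) (Fin n) (AlgebraicClosure F)) (hR : IsUnit R.det) (hD : D.IsDiag)
    (hP : P.map (algebraMap F (AlgebraicClosure F)) = R⁻¹ * D * R)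
    (hμ : ∀ μ ∈ spectrum (AlgebraicClosure F) (P.map (algebraMap F (AlgebraicClosure F))),
          ∃ q : ℚ, μ = (q : AlgebraicClosure F)) :
    (∃ (E : IntermediateField (RatFunc F) (AlgebraicClosure (RatFunc F))) (δE : E → E),
        (∀ x y : E, δE (x + y) = δE x + δE y) ∧
        (∀ x y : E, δE (x * y) = δE x * y + x * δE y) ∧
        (∀ a : RatFunc F,
          δE (algebraMap (RatFunc F) E a) = algebraMap (RatFunc F) E (δ a)) ∧
        FiniteDimensional (RatFunc F) E ∧
        ∃ Y : Matrix (Fin n) (Fin n) E, IsUnit Y.det ∧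
          Y.map δE
            = (P.map fun x =>
                algebraMap (RatFunc F) E (algebraMap F (RatFunc F) x))ᵀ * Y) := by
  have : CharZero (RatFunc F) :=
    charZero_of_injective_ringHom (algebraMap F (RatFunc F)).injective
  have hRP : R * P.map (algebraMap F (AlgebraicClosure F)) = D * R := by
    rw [hP, Matrix.mul_assoc, mul_nonsing_inv_cancel_left _ _ hR]
  have hspec : ∀ k, ∃ q : ℚ, D k k = (q : AlgebraicClosure F) := by
    intro k
    apply hμ
    have hu : IsUnit R := (Matrix.isUnit_iff_isUnit_det _).mpr hR
    have h1 : spectrum (AlgebraicClosure F) (R⁻¹ * D * R) = spectrum (AlgebraicClosure F) D := by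
      obtain ⟨U, rfl⟩ := hu
      rw [← Matrix.coe_units_inv]
      exact spectrum.units_conjugate' 
    rw [hP, h1, ← hD.diagonal_diag, spectrum_diagonal]
    exact ⟨k, by simp⟩
  choose q hq using hspec
  let L := AlgebraicClosure (RatFunc F)
  let j : AlgebraicClosure F →ₐ[F] L := IsAlgClosed.lift
  let t : L := algebraMap (RatFunc F) L RatFunc.X
  have hroot : ∀ k, ∃ u : L, u ^ (q k).den = t ^ (q k).num := fun k =>
    IsAlgClosed.exists_pow_nat_eq _ (q k).pos
  choose u hu using hroot
  let E : IntermediateField (RatFunc F) L := IntermediateField.adjoin (RatFunc F)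
    (Set.range u ∪ Set.range (fun p : Fin n × Fin n => j (R p.1 p.2)))
  have hfin : FiniteDimensional (RatFunc F) E := by
    have : Finite ↑(Set.range u ∪ Set.range (fun p : Fin n × Fin n => j (R p.1 p.2))) :=
      ((Set.finite_range _).union (Set.finite_range _)).to_subtype
    apply IntermediateField.finiteDimensional_adjoin
    intro x _
    exact Algebra.IsIntegral.isIntegral x
  let dK : Differential (RatFunc F) := mkDiff δ hadd hmul
  let dE : Differential E := Differential.differentialFiniteDimensional (RatFunc F) E
  have hd : DifferentialAlgebra (RatFunc F) E := Differential.differentialAlgebraFiniteDimensional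
  let v : Fin n → E := fun k => ⟨u k, IntermediateField.subset_adjoin _ _ (Or.inl ⟨k, rfl⟩)⟩
  let r : Matrix (Fin n) (Fin n) E := fun k i =>
    ⟨j (R k i), IntermediateField.subset_adjoin _ _ (Or.inr ⟨(k, i), rfl⟩)⟩
  let τ : E := algebraMap (RatFunc F) E RatFunc.X
  have hτ0 : τ ≠ 0 := by simpa [τ] using RatFunc.X_ne_zero
  have hτ : τ′ = τ := by
    change (algebraMap (RatFunc F) E RatFunc.X)′ = _
    rw [deriv_algebraMap]
    change algebraMap (RatFunc F) E (δ RatFunc.X) = _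
    rw [ht]
  have hv : ∀ k, v k ^ (q k).den = τ ^ (q k).num := by
    intro k
    apply E.val.toRingHom.injective
    change E.val _ = E.val _
    rw [map_pow, map_zpow₀]
    exact hu k
  have hEz : CharZero E := charZero_of_injective_ringHom (algebraMap (RatFunc F) E).injective
  have hvd : ∀ k, (v k)′ = (q k : E) * v k := fun k => root_deriv τ _ hτ0 hτ _ (hv k)
  have hv0 : ∀ k, v k ≠ 0 := by
    intro k h0
    have := hv k
    rw [h0, zero_pow (q k).den_nz] at this
    exact zpow_ne_zero _ hτ0 this.symm
  have hr : ∀ k i, (r k i)′ = 0 := by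
    intro k i
    apply const_of_alg (F := F)
    · intro a
      rw [IsScalarTower.algebraMap_apply F (RatFunc F) E, deriv_algebraMap]
      change algebraMap (RatFunc F) E (δ _) = 0
      rw [hF, map_zero]
    · have h1 : IsIntegral F (j (R k i)) := (Algebra.IsIntegral.isIntegral (R k i)).map j
      have h2 : (E.val.restrictScalars F) (r k i) = j (R k i) := rfl
      rw [← h2] at h1
      exact (isIntegral_algHom_iff _ (E.val.restrictScalars F).injective).mp h1
  have hrP : ∀ k i, ∑ l, r k l * algebraMap (RatFunc F) E (algebraMap F (RatFunc F) (P l i))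
      = (q k : E) * r k i := by
    intro k i
    apply E.val.toRingHom.injective
    have h1 := congrArg j (congrFun (congrFun hRP k) i)
    rw [← hD.diagonal_diag, diagonal_mul, mul_apply, map_sum, map_mul, diag_apply, hq, 
      map_ratCast] at h1
    change E.val _ = E.val _
    rw [map_sum, map_mul, map_ratCast]
    refine Eq.trans ?_ h1
    refine Finset.sum_congr rfl fun l _ => ?_
    rw [map_mul, map_mul, map_apply, j.commutes, E.val.commutes,
      ← IsScalarTower.algebraMap_apply]
    rfl
  refine ⟨E, fun x => x′, fun x y => map_add _ x y, fun x y => ?_, fun a => deriv_algebraMap a, hfin,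
    rᵀ * diagonal v, ?_, ?_⟩
  · change (x * y)′ = (x′) * y + x * (y′)
    rw [Derivation.leibniz, smul_eq_mul, smul_eq_mul]; ring
  · rw [det_mul, det_transpose, det_diagonal]
    refine IsUnit.mul ?_ (isUnit_iff_ne_zero.mpr (Finset.prod_ne_zero_iff.mpr fun k _ => hv0 k))
    rw [isUnit_iff_ne_zero]
    intro h0
    have h1 : j R.det = E.val r.det := by
      rw [AlgHom.map_det, AlgHom.map_det]; rfl
    rw [h0, map_zero] at h1
    exact hR.ne_zero ((map_eq_zero j).mp h1)
  · ext1 i k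
    rw [map_apply, mul_diagonal, ← Matrix.mul_assoc, mul_diagonal, Derivation.leibniz,
      transpose_apply, hr, hvd, mul_apply]
    simp only [transpose_apply, map_apply, smul_eq_mul, mul_zero, add_zero]
    have := hrP k i
    simp only [mul_comm (r _ _)] at this
    rw [this]; ring

/-- Let `K = F(t)` with `δ|_F = 0`, `δ(t) = t`, and let `P ∈ Mₙ(F)` be traceless.
The differential matrix algebra `(Mₙ(K), D_P)` (with `D_P(X) = δᶜ(X) + PX - XP`) admits a finite
splitting field over `(K, δ)` — i.e. there is a finite differential extension `(E, δ_E)` over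
which `δᶜ(Y) = Pᵀ Y` has an invertible solution — iff `P` is diagonalizable over the algebraic
closure of `F` and every eigenvalue of `P` is rational. -/
theorem stmt16 {F : Type*} [Field F] [CharZero F] {n : ℕ}
    (δ : RatFunc F → RatFunc F)
    (hadd : ∀ x y : RatFunc F, δ (x + y) = δ x + δ y)
    (hmul : ∀ x y : RatFunc F, δ (x * y) = δ x * y + x * δ y)
    (hF : ∀ a : F, δ (algebraMap F (RatFunc F) a) = 0)
    (ht : δ RatFunc.X = RatFunc.X)
    (P : Matrix (Fin n) (Fin n) F) (htr : P.trace = 0) :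
    (∃ (E : IntermediateField (RatFunc F) (AlgebraicClosure (RatFunc F))) (δE : E → E),
        (∀ x y : E, δE (x + y) = δE x + δE y) ∧
        (∀ x y : E, δE (x * y) = δE x * y + x * δE y) ∧
        (∀ a : RatFunc F,
          δE (algebraMap (RatFunc F) E a) = algebraMap (RatFunc F) E (δ a)) ∧
        FiniteDimensional (RatFunc F) E ∧
        ∃ Y : Matrix (Fin n) (Fin n) E, IsUnit Y.det ∧
          Y.map δE
            = (P.map fun x =>
                algebraMap (RatFunc F) E (algebraMap F (RatFunc F) x))ᵀ * Y) ↔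
      ((∃ R D : Matrix (Fin n) (Fin n) (AlgebraicClosure F),
          IsUnit R.det ∧ D.IsDiag ∧
            P.map (algebraMap F (AlgebraicClosure F)) = R⁻¹ * D * R) ∧
        ∀ μ ∈ spectrum (AlgebraicClosure F) (P.map (algebraMap F (AlgebraicClosure F))),
          ∃ q : ℚ, μ = (q : AlgebraicClosure F)) := by
  constructor
  · rintro ⟨E, δE, eadd, emul, ealg, hfin, Y, hY, hYP⟩
    exact forward δ hadd hmul hF ht P δE eadd emul ealg Y hY hYP
  · rintro ⟨⟨R, D, hR, hD, hP⟩, hμ⟩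
    exact backward δ hadd hmul hF ht P R D hR hD hP hμ
end
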